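/- arXiv:1810.12998 — 2 statements merged into one kernel-verified Lean document; each statement's English description precedes it below -/
import Mathlib

section
/- Let n be a positive integer. If X is an S(n)-space, then |X| ≤ 2^{s(X)·2^{s_n(X)}}, where s(X) is the usual spread. -/
open Cardinal Set

universe u

variable {X : Type u}

/-- `x` is S(n)-separated from `A`. -/
def SSep [TopologicalSpace X] : ℕ → X → Set X → Prop
  | 0, x, A => x ∉ closure A
  | (n+1), x, A => ∃ U : ℕ → Set X, (∀ i ≤ n, IsOpen (U i)) ∧ x ∈ U 0 ∧
      (∀ i < n, closure (U i) ⊆ U (i+1)) ∧ closure (U n) ∩ A = ∅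

/-- `X` is an S(n)-space. -/
def SSpace (n : ℕ) (X : Type u) [TopologicalSpace X] : Prop :=
  ∀ x y : X, x ≠ y → SSep n x {y}

/-- `U` is an S(2k-1)-neighborhood of `x` (for `k ≥ 1`). -/
def SOddNhd [TopologicalSpace X] (k : ℕ) (x : X) (U : Set X) : Prop :=
  ∃ V : ℕ → Set X, (∀ i < k, IsOpen (V i)) ∧ x ∈ V 0 ∧
    (∀ i, i + 1 < k → closure (V i) ⊆ V (i+1)) ∧ V (k-1) ⊆ U

/-- `U` is an S(2k)-neighborhood of `x` (for `k ≥ 1`). -/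
def SEvenNhd [TopologicalSpace X] (k : ℕ) (x : X) (U : Set X) : Prop :=
  ∃ V : ℕ → Set X, (∀ i < k, IsOpen (V i)) ∧ x ∈ V 0 ∧
    (∀ i, i + 1 < k → closure (V i) ⊆ V (i+1)) ∧ closure (V (k-1)) ⊆ U

/-- `U` is an open S(2k-1)-neighborhood of `x`. -/
def SOpenNhd [TopologicalSpace X] (k : ℕ) (x : X) (U : Set X) : Prop :=
  IsOpen U ∧ SOddNhd k x U

/-- `U` is an S(2k-1)-open set. -/
def SOpen [TopologicalSpace X] (k : ℕ) (U : Set X) : Prop :=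
  IsOpen U ∧ ∃ x, SOddNhd k x U

/-- The S(2k-1)-closure `θ_{2k-1}(A)`. -/
def thetaOdd [TopologicalSpace X] (k : ℕ) (A : Set X) : Set X :=
  {x | ∀ U : Set X, SOpenNhd k x U → (U ∩ A).Nonempty}

/-- The S(2k)-closure `θ_{2k}(A)`. -/
def thetaEven [TopologicalSpace X] (k : ℕ) (A : Set X) : Set X :=
  {x | ∀ U : Set X, SOpenNhd k x U → (closure U ∩ A).Nonempty}

/-- `D` is S(2k-1)-discrete. -/
def SOddDiscrete [TopologicalSpace X] (k : ℕ) (D : Set X) : Prop :=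
  ∀ x ∈ D, ∃ U : Set X, SOpenNhd k x U ∧ U ∩ D = {x}

/-- `D` is S(2k)-discrete. -/
def SEvenDiscrete [TopologicalSpace X] (k : ℕ) (D : Set X) : Prop :=
  ∀ x ∈ D, ∃ U : Set X, SOpenNhd k x U ∧ closure U ∩ D = {x}

/-- The S(2k-1)-spread `s_{2k-1}(X)`. -/
noncomputable def spreadOdd (k : ℕ) (X : Type u) [TopologicalSpace X] : Cardinal :=
  (⨆ D : {D : Set X // SOddDiscrete k D}, #D.1) ⊔ Cardinal.aleph0

/-- The S(2k)-spread `s_{2k}(X)`. -/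
noncomputable def spreadEven (k : ℕ) (X : Type u) [TopologicalSpace X] : Cardinal :=
  (⨆ D : {D : Set X // SEvenDiscrete k D}, #D.1) ⊔ Cardinal.aleph0

/-- The S(2k-1)-cellularity `c_{2k-1}(X)`. -/
noncomputable def cellOdd (k : ℕ) (X : Type u) [TopologicalSpace X] : Cardinal :=
  (⨆ F : {F : Set (Set X) // (∀ U ∈ F, SOpen k U ∧ U.Nonempty) ∧
      (∀ U ∈ F, ∀ V ∈ F, U ≠ V → U ∩ V = ∅)}, #F.1) ⊔ Cardinal.aleph0

/-- The S(2k)-cellularity `c_{2k}(X)`. -/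
noncomputable def cellEven (k : ℕ) (X : Type u) [TopologicalSpace X] : Cardinal :=
  (⨆ F : {F : Set (Set X) // (∀ U ∈ F, SOpen k U ∧ U.Nonempty) ∧
      (∀ U ∈ F, ∀ V ∈ F, U ≠ V → closure U ∩ closure V = ∅)}, #F.1) ⊔ Cardinal.aleph0

/-- The S(2k-1)-character `χ_{2k-1}(X)`. -/
noncomputable def charOdd (k : ℕ) (X : Type u) [TopologicalSpace X] : Cardinal :=
  sInf {c | Cardinal.aleph0 ≤ c ∧ ∀ x : X, ∃ B : Set (Set X), #B ≤ c ∧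
    (∀ U ∈ B, SOpenNhd k x U) ∧
    ∀ U : Set X, SOpenNhd k x U → ∃ V ∈ B, V ⊆ U}

/-- The S(2k)-character `χ_{2k}(X)`. -/
noncomputable def charEven (k : ℕ) (X : Type u) [TopologicalSpace X] : Cardinal :=
  sInf {c | Cardinal.aleph0 ≤ c ∧ ∀ x : X, ∃ B : Set (Set X), #B ≤ c ∧
    (∀ V ∈ B, IsClosed V ∧ SOddNhd k x V) ∧
    ∀ W : Set X, SOpenNhd k x W → ∃ V ∈ B, V ⊆ closure W}

/-- The S(2k-1)-pseudocharacter `ψ_{2k-1}(X)`. -/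
noncomputable def psiOdd (k : ℕ) (X : Type u) [TopologicalSpace X] : Cardinal :=
  sInf {c | Cardinal.aleph0 ≤ c ∧ ∀ x : X, ∃ B : Set (Set X), #B ≤ c ∧
    (∀ U ∈ B, SOpenNhd k x U) ∧ ⋂₀ B = {x}}

/-- The S(2k)-pseudocharacter `ψ_{2k}(X)`. -/
noncomputable def psiEven (k : ℕ) (X : Type u) [TopologicalSpace X] : Cardinal :=
  sInf {c | Cardinal.aleph0 ≤ c ∧ ∀ x : X, ∃ B : Set (Set X), #B ≤ c ∧
    (∀ U ∈ B, SOpenNhd k x U) ∧ (⋂ U ∈ B, closure U) = {x}}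

/-- The usual pseudocharacter `ψ(X)`. -/
noncomputable def psi (X : Type u) [TopologicalSpace X] : Cardinal :=
  sInf {c | Cardinal.aleph0 ≤ c ∧ ∀ x : X, ∃ B : Set (Set X), #B ≤ c ∧
    (∀ U ∈ B, IsOpen U) ∧ ⋂₀ B = {x}}

/-- The S(n)-spread `s_n(X)` for arbitrary positive `n`. -/
noncomputable def spreadN (n : ℕ) (X : Type u) [TopologicalSpace X] : Cardinal :=
  if n % 2 = 1 then spreadOdd ((n + 1) / 2) X else spreadEven (n / 2) X


/-- A version of the Erdős–Rado theorem `(2^κ)⁺ → (κ⁺)²_κ`, for colourings of ordered pairs. -/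
theorem erdos_rado_aux {X K : Type u} [Infinite K] [LinearOrder X] [WellFoundedLT X]
    (c : X → X → K) (hX : (2 : Cardinal.{u}) ^ #K < #X) :
    ∃ (H : Set X) (k : K), #K < #H ∧ ∀ x ∈ H, ∀ y ∈ H, x < y → c x y = k := by
  classical
  let R : X → X → Prop := fun x => (wellFounded_lt (α := X)).fix
    (fun a ih => a < x ∧ ∀ b (hb : b < a), ih b hb → c b a = c b x)
  have hR : ∀ x a, R x a ↔ (a < x ∧ ∀ b, b < a → R x b → c b a = c b x) := by
    intro x a
    have := (wellFounded_lt (α := X)).fix_eq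
      (C := fun _ => Prop) (fun a ih => a < x ∧ ∀ b (hb : b < a), ih b hb → c b a = c b x) a
    exact iff_of_eq this
  -- some branch is large
  have hbig : ∃ x, #K < #{a | R x a} := by
    by_contra hcon
    push Not at hcon
    have he : ∀ x, ∃ e : {a | R x a} → K, Function.Injective e := by
      intro x
      obtain ⟨f⟩ := hcon x
      exact ⟨f, f.injective⟩
    choose e hinj using he
    let code : X → Set (K × K) × Set (K × K) := fun x =>
      ({z | ∃ a b : {a | R x a}, a.1 ≤ b.1 ∧ z = (e x a, e x b)},
       {z | ∃ a : {a | R x a}, z = (e x a, c a.1 x)})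
    have key : ∀ x y, code x = code y → ∀ a : X, ∀ ha : R x a, ∀ a' : X, ∀ ha' : R y a',
        e x ⟨a, ha⟩ = e y ⟨a', ha'⟩ → a = a' := by
      intro x y hxy
      have h1 : ∀ a b : {a | R x a}, a.1 ≤ b.1 → ∃ a' b' : {a | R y a}, a'.1 ≤ b'.1 ∧
          e x a = e y a' ∧ e x b = e y b' := by
        intro a b hab
        have : (e x a, e x b) ∈ (code x).1 := ⟨a, b, hab, rfl⟩
        rw [hxy] at this
        obtain ⟨a', b', h, h'⟩ := this
        exact ⟨a', b', h, (Prod.ext_iff.1 h').1, (Prod.ext_iff.1 h').2⟩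
      have h2 : ∀ a b : {a | R y a}, a.1 ≤ b.1 → ∃ a' b' : {a | R x a}, a'.1 ≤ b'.1 ∧
          e y a = e x a' ∧ e y b = e x b' := by
        intro a b hab
        have : (e y a, e y b) ∈ (code y).1 := ⟨a, b, hab, rfl⟩
        rw [← hxy] at this
        obtain ⟨a', b', h, h'⟩ := this
        exact ⟨a', b', h, (Prod.ext_iff.1 h').1, (Prod.ext_iff.1 h').2⟩
      have h3 : ∀ (a : {a | R x a}) (a' : {a | R y a}), e x a = e y a' → c a.1 x = c a'.1 y := by
        intro a a' haa
        have : (e x a, c a.1 x) ∈ (code x).2 := ⟨a, rfl⟩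
        rw [hxy] at this
        obtain ⟨b, hb⟩ := this
        have hb1 := (Prod.ext_iff.1 hb).1
        have hb2 := (Prod.ext_iff.1 hb).2
        simp only at hb1 hb2
        rw [haa] at hb1
        rw [hb2, hinj y hb1]
      intro a
      induction a using WellFoundedLT.induction with
      | ind a ih =>
        intro ha a' ha' haa
        have p1 : ∀ b, b < a → R x b → b < a' ∧ R y b ∧ c b x = c b y := by
          intro b hb hxb
          obtain ⟨b', d', hbd, hb', hd'⟩ := h1 ⟨b, hxb⟩ ⟨a, ha⟩ hb.le
          have hd : d' = ⟨a', ha'⟩ := hinj y (hd'.symm.trans haa)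
          subst hd
          have hbb : b = b'.1 := ih b hb hxb b'.1 b'.2 hb'
          have hc := h3 _ _ hb'
          have hne : b'.1 ≠ a' := by
            intro h
            have h' : b' = ⟨a', ha'⟩ := Subtype.ext h
            rw [h', ← haa] at hb'
            have := congrArg Subtype.val (hinj x hb')
            exact hb.ne this
          refine ⟨?_, ?_, ?_⟩
          · rw [hbb]; exact lt_of_le_of_ne hbd hne
          · rw [hbb]; exact b'.2
          · simp only at hc
            rw [hc, ← hbb]
        have p2 : ∀ b, b < a' → R y b → b < a ∧ R x b ∧ c b x = c b y := by
          intro b hb hyb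
          obtain ⟨b', d', hbd, hb', hd'⟩ := h2 ⟨b, hyb⟩ ⟨a', ha'⟩ hb.le
          have hd : d' = ⟨a, ha⟩ := hinj x (hd'.symm.trans haa.symm)
          subst hd
          have hne : b'.1 ≠ a := by
            intro h
            have h' : b' = ⟨a, ha⟩ := Subtype.ext h
            rw [h', haa] at hb'
            have := congrArg Subtype.val (hinj y hb')
            exact hb.ne this
          have hlt : b'.1 < a := lt_of_le_of_ne hbd hne
          have hbb : b'.1 = b := ih b'.1 hlt b'.2 b hyb hb'.symm
          have hc := h3 _ _ hb'.symm
          refine ⟨hbb ▸ hlt, hbb ▸ b'.2, ?_⟩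
          simp only at hc
          rw [← hc, hbb]
        rcases lt_trichotomy a a' with hlt | heq | hgt
        · exfalso
          have : R y a := by
            rw [hR]
            refine ⟨hlt.trans ((hR y a').1 ha').1, fun b hb hyb => ?_⟩
            obtain ⟨_, hxb, hc⟩ := p2 b (hb.trans hlt) hyb
            rw [← hc]
            exact ((hR x a).1 ha).2 b hb hxb
          exact lt_irrefl _ (p2 a hlt this).1
        · exact heq
        · exfalso
          have : R x a' := by
            rw [hR]
            refine ⟨hgt.trans ((hR x a).1 ha).1, fun b hb hxb => ?_⟩
            obtain ⟨_, hyb, hc⟩ := p1 b (hb.trans hgt) hxb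
            rw [hc]
            exact ((hR y a').1 ha').2 b hb hyb
          exact lt_irrefl _ (p1 a' hgt this).1
    -- transfer of membership and colours
    have trans : ∀ x y, code x = code y → ∀ a, R x a → R y a ∧ c a x = c a y := by
      intro x y hxy a ha
      have : (e x ⟨a, ha⟩, c a x) ∈ (code x).2 := ⟨⟨a, ha⟩, rfl⟩
      rw [hxy] at this
      obtain ⟨b, hb⟩ := this
      have hb1 := (Prod.ext_iff.1 hb).1
      have hb2 := (Prod.ext_iff.1 hb).2
      have hab : a = b.1 := key x y hxy a ha b.1 b.2 hb1
      simp only at hb2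
      refine ⟨hab ▸ b.2, ?_⟩
      rw [hb2, ← hab]
    have hlt : ∀ x y, code x = code y → ¬ x < y := by
      intro x y hxy hlt
      have : R y x := by
        rw [hR]
        refine ⟨hlt, fun b hb hyb => ?_⟩
        exact ((trans y x hxy.symm b hyb).2).symm
      have h' := (trans y x hxy.symm x this).1
      exact lt_irrefl _ ((hR x x).1 h').1
    have cinj : Function.Injective code := by
      intro x y hxy
      rcases lt_trichotomy x y with h | h | h
      · exact absurd h (hlt x y hxy)
      · exact h
      · exact absurd h (hlt y x hxy.symm)
    have hle := Cardinal.mk_le_of_injective cinj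
    have hK : #K * #K = #K := Cardinal.mul_eq_self (Cardinal.aleph0_le_mk K)
    have : #(Set (K × K) × Set (K × K)) = 2 ^ #K := by
      rw [Cardinal.mk_prod, Cardinal.lift_id, Cardinal.mk_set, Cardinal.mk_prod,
        Cardinal.lift_id, hK]
      exact Cardinal.mul_eq_self
        ((Cardinal.aleph0_le_mk K).trans (Cardinal.cantor _).le)
    rw [this] at hle
    exact absurd hX (not_lt.2 hle)
  obtain ⟨x, hx⟩ := hbig
  by_contra hcon
  push Not at hcon
  have hfib : ∀ k : K, #{a | R x a ∧ c a x = k} ≤ #K := by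
    intro k
    by_contra hk
    push Not at hk
    obtain ⟨a, ha, b, hb, hab, hne⟩ := hcon {a | R x a ∧ c a x = k} k hk
    apply hne
    rw [((hR x b).1 hb.1).2 a hab ha.1, ha.2]
  have hU : {a | R x a} = ⋃ k : K, {a | R x a ∧ c a x = k} := by
    ext a; simp
  have : #{a | R x a} ≤ #K := by
    rw [hU]
    refine (Cardinal.mk_iUnion_le _).trans ?_
    calc #K * (⨆ k : K, #{a | R x a ∧ c a x = k}) ≤ #K * #K :=
          mul_le_mul' le_rfl (ciSup_le' hfib)
      _ = #K := Cardinal.mul_eq_self (Cardinal.aleph0_le_mk K)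
  exact absurd hx (not_lt.2 this)

/-- Abstract bound on the pseudocharacter. -/
theorem psi_aux {X : Type u} [TopologicalSpace X] (N : X → Set X → Prop)
    (hmem : ∀ x T, N x T → x ∈ T)
    (hinter : ∀ x S T, N x S → N x T → N x (S ∩ T))
    (hmono : ∀ x S T, N x S → S ⊆ T → N x T)
    (hopen : ∀ x T, N x T → ∃ G, IsOpen G ∧ x ∈ G ∧ ∀ y ∈ G, N y T)
    (hsep : ∀ p q, q ≠ p → ∃ T, N q T ∧ N p Tᶜ)
    (l : Cardinal.{u}) (hl : ℵ₀ ≤ l)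
    (hdisc : ∀ D : Set X, (∀ x ∈ D, ∃ T, N x T ∧ T ∩ D = {x}) → #D ≤ l)
    (K : Type u) (hK : 2 ^ l ≤ #K) (p : X) :
    ∃ V : K → Set X, (∀ i, IsOpen (V i) ∧ p ∈ V i) ∧ ∀ q, q ≠ p → ∃ i, q ∉ V i := by
  classical
  have hsep' : ∀ q, ∃ T, q ≠ p → N q T ∧ N p Tᶜ := by
    intro q
    by_cases hq : q = p
    · exact ⟨univ, fun h => absurd hq h⟩
    · obtain ⟨T, hT⟩ := hsep p q hq
      exact ⟨T, fun _ => hT⟩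
  choose T hT using hsep'
  obtain ⟨lo, wf⟩ := exists_wellOrder X
  let A : X → Prop := (wellFounded_lt (α := X)).fix
    (fun q ih => q ≠ p ∧ ∃ W, N q W ∧ ∀ a (h : a < q), ih a h → a ∉ W ∧ q ∉ T a)
  have hA : ∀ q, A q ↔ (q ≠ p ∧ ∃ W, N q W ∧ ∀ a, a < q → A a → a ∉ W ∧ q ∉ T a) := by
    intro q
    have := (wellFounded_lt (α := X)).fix_eq (C := fun _ => Prop)
      (fun q ih => q ≠ p ∧ ∃ W, N q W ∧ ∀ a (h : a < q), ih a h → a ∉ W ∧ q ∉ T a) q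
    exact iff_of_eq this
  have hAcard : #{a | A a} ≤ l := by
    apply hdisc
    intro x hx
    obtain ⟨hxp, W, hW, hx2⟩ := (hA x).1 hx
    refine ⟨W ∩ T x, hinter _ _ _ hW (hT x hxp).1, ?_⟩
    ext y
    constructor
    · rintro ⟨⟨hy1, hy2⟩, hy⟩
      rcases lt_trichotomy y x with h | h | h
      · exact absurd hy1 (hx2 y h hy).1
      · exact h
      · obtain ⟨-, W', -, hy3⟩ := (hA y).1 hy
        exact absurd hy2 (hy3 x h hx).2
    · rintro rfl
      exact ⟨⟨hmem _ _ hW, hmem _ _ (hT _ hxp).1⟩, hx⟩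
  -- the open neighbourhoods of p
  have hG : ∀ B : Set X, ∃ G, IsOpen G ∧ p ∈ G ∧ (N p Bᶜ → ∀ y ∈ G, N y Bᶜ) := by
    intro B
    by_cases h : N p Bᶜ
    · obtain ⟨G, h1, h2, h3⟩ := hopen p _ h
      exact ⟨G, h1, h2, fun _ => h3⟩
    · exact ⟨univ, isOpen_univ, mem_univ _, fun h' => absurd h' h⟩
  choose G hG1 hG2 hG3 using hG
  let F : Set {a | A a} ⊕ {a | A a} → Set X :=
    Sum.elim (fun B => G (Subtype.val '' B)) (fun a => G (T a.1))
  have hF1 : ∀ j, IsOpen (F j) ∧ p ∈ F j := by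
    rintro (B | a)
    · exact ⟨hG1 _, hG2 _⟩
    · exact ⟨hG1 _, hG2 _⟩
  have hF2 : ∀ q, q ≠ p → ∃ j, q ∉ F j := by
    intro q hq
    by_cases hqT : ∃ a, A a ∧ q ∈ T a
    · obtain ⟨a, ha, hqa⟩ := hqT
      refine ⟨Sum.inr ⟨a, ha⟩, fun hmq => ?_⟩
      have hap : a ≠ p := ((hA a).1 ha).1
      exact hmem _ _ (hG3 (T a) (hT a hap).2 q hmq) hqa
    · push Not at hqT
      have hqA : ¬ A q := fun h => hqT q h (hmem _ _ (hT q hq).1)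
      refine ⟨Sum.inl {a | a.1 ∈ T q}, fun hmq => ?_⟩
      have hnp : N p (Subtype.val '' {a : {a | A a} | a.1 ∈ T q})ᶜ := by
        refine hmono _ _ _ (hT q hq).2 ?_
        rintro z hz ⟨a, ha, rfl⟩
        exact hz ha
      have hnq := hG3 _ hnp q hmq
      apply hqA
      rw [hA]
      refine ⟨hq, _, hinter _ _ _ hnq (hT q hq).1, fun a _ ha => ⟨?_, hqT a ha⟩⟩
      rintro ⟨h1, h2⟩
      exact h1 ⟨⟨a, ha⟩, h2, rfl⟩
  have hcard : #(Set {a | A a} ⊕ {a | A a}) ≤ #K := by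
    refine le_trans ?_ hK
    rw [Cardinal.mk_sum, Cardinal.lift_id, Cardinal.lift_id, Cardinal.mk_set]
    have h2l : ℵ₀ ≤ (2 : Cardinal.{u}) ^ l := hl.trans (Cardinal.cantor _).le
    refine Cardinal.add_le_of_le h2l ?_ (hAcard.trans (Cardinal.cantor _).le)
    exact Cardinal.power_le_power_left two_ne_zero hAcard
  obtain ⟨f⟩ := hcard
  haveI : Nonempty (Set {a | A a} ⊕ {a | A a}) := ⟨Sum.inl ∅⟩
  refine ⟨fun i => F (Function.invFun f i), fun i => hF1 _, fun q hq => ?_⟩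
  obtain ⟨j, hj⟩ := hF2 q hq
  refine ⟨f j, ?_⟩
  simpa only [Function.leftInverse_invFun f.injective j] using hj

theorem main_aux {X : Type u} [TopologicalSpace X] (N : X → Set X → Prop)
    (hmem : ∀ x T, N x T → x ∈ T)
    (hinter : ∀ x S T, N x S → N x T → N x (S ∩ T))
    (hmono : ∀ x S T, N x S → S ⊆ T → N x T)
    (hopen : ∀ x T, N x T → ∃ G, IsOpen G ∧ x ∈ G ∧ ∀ y ∈ G, N y T)
    (hsep : ∀ p q, q ≠ p → ∃ T, N q T ∧ N p Tᶜ)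
    (l : Cardinal.{u}) (hl : ℵ₀ ≤ l)
    (hdisc : ∀ D : Set X, (∀ x ∈ D, ∃ T, N x T ∧ T ∩ D = {x}) → #D ≤ l) :
    #X ≤ 2 ^ (spreadOdd 1 X * 2 ^ l) := by
  classical
  by_contra hcon
  push Not at hcon
  have hs : ℵ₀ ≤ spreadOdd 1 X := le_sup_right
  have h2 : ℵ₀ ≤ (2 : Cardinal.{u}) ^ l := hl.trans (Cardinal.cantor _).le
  set κ := spreadOdd 1 X * 2 ^ l with hκ
  have hsκ : spreadOdd 1 X ≤ κ :=
    Cardinal.le_mul_right (Cardinal.aleph0_pos.trans_le h2).ne'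
  have hlκ : 2 ^ l ≤ κ := Cardinal.le_mul_left (Cardinal.aleph0_pos.trans_le hs).ne'
  have hκ0 : ℵ₀ ≤ κ := hs.trans hsκ
  have hKc : #κ.out = κ := Cardinal.mk_out κ
  haveI : Infinite κ.out := by rw [Cardinal.infinite_iff, hKc]; exact hκ0
  have hV := psi_aux N hmem hinter hmono hopen hsep l hl hdisc κ.out (by rw [hKc]; exact hlκ)
  choose V hV1 hV2 using hV
  have hc : ∀ x y : X, ∃ i : κ.out, y ≠ x → y ∉ V x i := by
    intro x y
    by_cases hxy : y = x
    · exact ⟨Classical.arbitrary _, fun h => absurd hxy h⟩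
    · obtain ⟨i, hi⟩ := hV2 x y hxy
      exact ⟨i, fun _ => hi⟩
  choose c hc using hc
  obtain ⟨lo, wf⟩ := exists_wellOrder X
  have hPc : #(κ.out × κ.out) = κ := by
    rw [Cardinal.mk_prod, Cardinal.lift_id, hKc, Cardinal.mul_eq_self hκ0]
  obtain ⟨H, k, hH, hHk⟩ := erdos_rado_aux (K := κ.out × κ.out)
    (fun x y => (c x y, c y x)) (by rw [hPc]; exact hcon)
  rw [hPc] at hH
  have hd : SOddDiscrete 1 H := by
    intro x hx
    have ho : IsOpen (V x k.1 ∩ V x k.2) := (hV1 x _).1.inter (hV1 x _).1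
    have hxm : x ∈ V x k.1 ∩ V x k.2 := ⟨(hV1 x _).2, (hV1 x _).2⟩
    refine ⟨V x k.1 ∩ V x k.2, ⟨ho, fun _ => V x k.1 ∩ V x k.2, fun _ _ => ho, hxm,
      fun i hi => by omega, subset_rfl⟩, ?_⟩
    ext y
    constructor
    · rintro ⟨⟨h1, h2⟩, hy⟩
      rcases lt_trichotomy x y with h | h | h
      · have := hHk x hx y hy h
        rw [← this] at h1
        exact absurd h1 (hc x y h.ne')
      · exact h.symm
      · have := hHk y hy x hx h
        rw [← this] at h2
        exact absurd h2 (hc x y h.ne)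
    · rintro rfl
      exact ⟨hxm, hx⟩
  have : #H ≤ spreadOdd 1 X :=
    (le_ciSup (f := fun D : {D : Set X // SOddDiscrete 1 D} => #D.1)
      (Cardinal.bddAbove_range _) ⟨H, hd⟩).trans le_sup_left
  exact absurd hH (not_lt.2 (this.trans hsκ))

theorem chain_mem {X : Type u} [TopologicalSpace X] {k : ℕ} {x : X} {V : ℕ → Set X}
    (h0 : x ∈ V 0) (hV : ∀ i, i + 1 < k → closure (V i) ⊆ V (i + 1)) :
    ∀ i, i < k → x ∈ V i := by
  intro i
  induction i with
  | zero => intro _; exact h0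
  | succ i ih => intro hi; exact hV i hi (subset_closure (ih (by omega)))

theorem closure_compl_aux {X : Type u} [TopologicalSpace X] {A B C : Set X}
    (hB : IsOpen B) (hAB : closure A ⊆ B) (hBC : B ⊆ C) :
    closure (closure C)ᶜ ⊆ (closure A)ᶜ := by
  have h1 : (closure C)ᶜ ⊆ Bᶜ := compl_subset_compl.2 (hBC.trans subset_closure)
  exact (closure_minimal h1 hB.isClosed_compl).trans (compl_subset_compl.2 hAB)

theorem stmt15 (n : ℕ) (hn : 1 ≤ n) (X : Type u) [TopologicalSpace X]
    (h : SSpace n X) :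
    #X ≤ 2 ^ (spreadOdd 1 X * 2 ^ spreadN n X) := by
  obtain ⟨m, rfl⟩ : ∃ m, n = m + 1 := ⟨n - 1, by omega⟩
  by_cases hpar : (m + 1) % 2 = 1
  · -- odd case
    obtain ⟨k, hk1, hk⟩ : ∃ k, 1 ≤ k ∧ m = 2 * k - 2 := ⟨(m + 2) / 2, by omega, by omega⟩
    have hspr : spreadN (m + 1) X = spreadOdd k X := by
      unfold spreadN
      rw [if_pos hpar]
      congr 1
      omega
    rw [hspr]
    refine main_aux (fun x T => SOddNhd k x T) ?_ ?_ ?_ ?_ ?_ _ le_sup_right ?_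
    · rintro x T ⟨V, h1, h2, h3, h4⟩
      exact h4 (chain_mem h2 h3 _ (by omega))
    · rintro x S T ⟨V, h1, h2, h3, h4⟩ ⟨V', h1', h2', h3', h4'⟩
      refine ⟨fun i => V i ∩ V' i, fun i hi => (h1 i hi).inter (h1' i hi), ⟨h2, h2'⟩,
        fun i hi => ?_, inter_subset_inter h4 h4'⟩
      exact (closure_inter_subset_inter_closure _ _).trans (inter_subset_inter (h3 i hi) (h3' i hi))
    · rintro x S T ⟨V, h1, h2, h3, h4⟩ hST
      exact ⟨V, h1, h2, h3, h4.trans hST⟩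
    · rintro x T ⟨V, h1, h2, h3, h4⟩
      exact ⟨V 0, h1 0 (by omega), h2, fun y hy => ⟨V, h1, hy, h3, h4⟩⟩
    · intro p q hqp
      obtain ⟨U, h1, h2, h3, h4⟩ := h q p hqp
      refine ⟨U (k - 1), ⟨U, fun i hi => h1 i (by omega), h2, fun i hi => h3 i (by omega),
        subset_rfl⟩, fun i => (closure (U (m - i)))ᶜ, fun i hi => isClosed_closure.isOpen_compl,
        ?_, ?_, ?_⟩
      · intro hp
        have : p ∈ closure (U m) ∩ {p} := ⟨hp, rfl⟩
        rw [h4] at this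
        exact this
      · intro i hi
        have hle : m - i = (m - (i + 1)) + 1 := by omega
        refine closure_compl_aux (h1 (m - i) (by omega)) ?_ subset_rfl
        rw [hle]
        exact h3 _ (by omega)
      · have : m - (k - 1) = k - 1 := by omega
        simp only [this]
        exact compl_subset_compl.2 subset_closure
    · intro D hD
      have hd : SOddDiscrete k D := by
        intro x hx
        obtain ⟨T, ⟨V, h1, h2, h3, h4⟩, hT⟩ := hD x hx
        refine ⟨V (k - 1), ⟨h1 _ (by omega), V, h1, h2, h3, subset_rfl⟩, ?_⟩
        apply Subset.antisymm
        · rw [← hT]; exact inter_subset_inter_left _ h4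
        · rintro y rfl
          exact ⟨chain_mem h2 h3 _ (by omega), hx⟩
      exact (le_ciSup (f := fun D : {D : Set X // SOddDiscrete k D} => #D.1)
        (Cardinal.bddAbove_range _) ⟨D, hd⟩).trans le_sup_left
  · -- even case
    obtain ⟨k, hk1, hk⟩ : ∃ k, 1 ≤ k ∧ m = 2 * k - 1 := ⟨(m + 1) / 2, by omega, by omega⟩
    have hspr : spreadN (m + 1) X = spreadEven k X := by
      unfold spreadN
      rw [if_neg hpar]
      congr 1
      omega
    rw [hspr]
    refine main_aux (fun x T => SEvenNhd k x T) ?_ ?_ ?_ ?_ ?_ _ le_sup_right ?_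
    · rintro x T ⟨V, h1, h2, h3, h4⟩
      exact h4 (subset_closure (chain_mem h2 h3 _ (by omega)))
    · rintro x S T ⟨V, h1, h2, h3, h4⟩ ⟨V', h1', h2', h3', h4'⟩
      refine ⟨fun i => V i ∩ V' i, fun i hi => (h1 i hi).inter (h1' i hi), ⟨h2, h2'⟩,
        fun i hi => ?_, (closure_inter_subset_inter_closure _ _).trans (inter_subset_inter h4 h4')⟩
      exact (closure_inter_subset_inter_closure _ _).trans (inter_subset_inter (h3 i hi) (h3' i hi))
    · rintro x S T ⟨V, h1, h2, h3, h4⟩ hST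
      exact ⟨V, h1, h2, h3, h4.trans hST⟩
    · rintro x T ⟨V, h1, h2, h3, h4⟩
      exact ⟨V 0, h1 0 (by omega), h2, fun y hy => ⟨V, h1, hy, h3, h4⟩⟩
    · intro p q hqp
      obtain ⟨U, h1, h2, h3, h4⟩ := h q p hqp
      refine ⟨closure (U (k - 1)), ⟨U, fun i hi => h1 i (by omega), h2,
        fun i hi => h3 i (by omega), subset_rfl⟩, fun i => (closure (U (m - i)))ᶜ,
        fun i hi => isClosed_closure.isOpen_compl, ?_, ?_, ?_⟩
      · intro hp
        have : p ∈ closure (U m) ∩ {p} := ⟨hp, rfl⟩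
        rw [h4] at this
        exact this
      · intro i hi
        have hle : m - i = (m - (i + 1)) + 1 := by omega
        refine closure_compl_aux (h1 (m - i) (by omega)) ?_ subset_rfl
        rw [hle]
        exact h3 _ (by omega)
      · have hle : m - (k - 1) = (k - 1) + 1 := by omega
        refine closure_compl_aux (h1 (m - (k - 1)) (by omega)) ?_ subset_rfl
        rw [hle]
        exact h3 _ (by omega)
    · intro D hD
      have hd : SEvenDiscrete k D := by
        intro x hx
        obtain ⟨T, ⟨V, h1, h2, h3, h4⟩, hT⟩ := hD x hx
        refine ⟨V (k - 1), ⟨h1 _ (by omega), V, h1, h2, h3, subset_rfl⟩, ?_⟩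
        apply Subset.antisymm
        · rw [← hT]; exact inter_subset_inter_left _ h4
        · rintro y rfl
          exact ⟨subset_closure (chain_mem h2 h3 _ (by omega)), hx⟩
      exact (le_ciSup (f := fun D : {D : Set X // SEvenDiscrete k D} => #D.1)
        (Cardinal.bddAbove_range _) ⟨D, hd⟩).trans le_sup_left
end

section
/- Let k be a positive integer. For every S(3k-2)-space X, ψ_{2k-1}(X) ≤ 2^{s_{2k-1}(X)}. -/
open Cardinal Set

universe u

variable {X : Type u}

theorem SOpenNhd.mem [TopologicalSpace X] {m : ℕ} {x : X} {U : Set X}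
    (h : SOpenNhd (m+1) x U) : x ∈ U := by
  obtain ⟨_, V, _, h0, hc, hU⟩ := h
  have : ∀ i, i < m + 1 → x ∈ V i := by
    intro i
    induction i with
    | zero => intro _; exact h0
    | succ n ih => intro hn; exact hc n hn (subset_closure (ih (by omega)))
  exact hU (this m (by omega))

theorem SOpenNhd.inter' [TopologicalSpace X] {k : ℕ} {x : X} {U V : Set X}
    (h : SOpenNhd k x U) (h' : SOpenNhd k x V) : SOpenNhd k x (U ∩ V) := by
  obtain ⟨o, P, p1, p2, p3, p4⟩ := h
  obtain ⟨o', Q, q1, q2, q3, q4⟩ := h'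
  refine ⟨o.inter o', fun i => P i ∩ Q i, fun i hi => (p1 i hi).inter (q1 i hi), ⟨p2, q2⟩, ?_, ?_⟩
  · intro i hi
    exact (closure_inter_subset_inter_closure _ _).trans (inter_subset_inter (p3 i hi) (q3 i hi))
  · exact inter_subset_inter p4 q4

theorem chain_compl [TopologicalSpace X] {m n j : ℕ} {z : X} {U : ℕ → Set X}
    (ho : ∀ i ≤ n, IsOpen (U i)) (hc : ∀ i < n, closure (U i) ⊆ U (i+1))
    (hj : j + m ≤ n) (hz : z ∉ closure (U (j + m))) :
    SOpenNhd (m+1) z (closure (U j))ᶜ := by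
  refine ⟨isClosed_closure.isOpen_compl, fun i => (closure (U (j + m - i)))ᶜ,
    fun i _ => isClosed_closure.isOpen_compl, by simpa using hz, ?_, ?_⟩
  · intro i hi
    have e : j + m - i = (j + m - (i + 1)) + 1 := by omega
    have h1 : closure ((closure (U (j + m - i)))ᶜ) ⊆ (U (j + m - i))ᶜ :=
      closure_minimal (compl_subset_compl.2 subset_closure)
        (ho _ (by omega)).isClosed_compl
    refine h1.trans (compl_subset_compl.2 ?_)
    have := hc (j + m - (i + 1)) (by omega)
    rwa [← e] at this
  · simp

/-- Shapirovskii-type covering lemma. -/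
theorem cover_lemma [TopologicalSpace X] (m : ℕ) (x : X) (W : X → Set X)
    (hW : ∀ y, y ≠ x → SOpenNhd (m+1) y (W y)) :
    ∃ D : Set X, x ∉ D ∧ SOddDiscrete (m+1) D ∧
      ∀ z, z ≠ x → z ∈ thetaOdd (m+1) D ∨ ∃ d ∈ D, z ∈ W d := by
  have wf : WellFounded (WellOrderingRel : X → X → Prop) := WellOrderingRel.isWellOrder.wf
  let F : (y : X) → ((d : X) → WellOrderingRel d y → Prop) → Prop := fun y ih =>
    y ≠ x ∧ y ∉ thetaOdd (m+1) {d | ∃ h : WellOrderingRel d y, ih d h} ∧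
      ∀ d, ∀ h : WellOrderingRel d y, ih d h → y ∉ W d
  let P : X → Prop := wf.fix F
  have hP : ∀ y, P y ↔ (y ≠ x ∧ y ∉ thetaOdd (m+1) {d | WellOrderingRel d y ∧ P d} ∧
      ∀ d, WellOrderingRel d y → P d → y ∉ W d) := by
    intro y
    have : P y = F y (fun d _ => P d) := wf.fix_eq F y
    rw [this]
    simp only [F, exists_prop]
  refine ⟨{y | P y}, fun hx => ((hP x).1 hx).1 rfl, ?_, ?_⟩
  · intro y hy
    obtain ⟨h1, h2, h3⟩ := (hP y).1 hy
    simp only [thetaOdd, mem_setOf_eq, not_forall] at h2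
    obtain ⟨U, hU, hne⟩ := h2
    refine ⟨U ∩ W y, hU.inter' (hW y h1), ?_⟩
    ext d
    simp only [mem_inter_iff, mem_setOf_eq, mem_singleton_iff]
    constructor
    · rintro ⟨⟨dU, dW⟩, dP⟩
      rcases trichotomous_of WellOrderingRel d y with hlt | heq | hgt
      · exact absurd ⟨d, dU, hlt, dP⟩ hne
      · exact heq
      · exact absurd dW (((hP d).1 dP).2.2 y hgt hy)
    · rintro rfl
      exact ⟨⟨hU.mem, (hW d h1).mem⟩, hy⟩
  · intro z hz
    by_cases hzP : P z
    · exact Or.inr ⟨z, hzP, (hW z hz).mem⟩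
    · by_contra hcon
      push Not at hcon
      refine hzP ((hP z).2 ⟨hz, fun ht => hcon.1 fun U hU => ?_, fun d _ hd => hcon.2 d hd⟩)
      exact (ht U hU).mono (inter_subset_inter_right _ fun d hd => hd.2)

theorem stmt17_aux [TopologicalSpace X] (m : ℕ) (h : SSpace (3 * m + 1) X) (x : X) :
    ∃ B : Set (Set X), #B ≤ 2 ^ spreadOdd (m+1) X ∧
    (∀ U ∈ B, SOpenNhd (m+1) x U) ∧ ⋂₀ B = {x} := by
  have key : ∀ y, ∃ W N : Set X, y ≠ x → SOpenNhd (m+1) y W ∧ SOpenNhd (m+1) x N ∧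
      Disjoint N W ∧ ∀ C ⊆ W, Disjoint N (thetaOdd (m+1) C) := by
    intro y
    by_cases hy : y = x
    · exact ⟨∅, ∅, fun h => absurd hy h⟩
    obtain ⟨U, ho, h0, hc, hx⟩ := h y x hy
    have hx' : x ∉ closure (U (3 * m)) := by simpa using hx
    have hth : ∀ C ⊆ U m, Disjoint (closure (U (m + m)))ᶜ (thetaOdd (m+1) C) := by
      intro C hC
      rw [Set.disjoint_left]
      intro z hz hz'
      obtain ⟨w, hw, hwC⟩ := hz' _ (chain_compl ho hc (by omega) hz)
      exact hw (subset_closure (hC hwC))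
    have hx2 : x ∉ closure (U ((m + m) + m)) := by
      rwa [show m + m + m = 3 * m by ring]
    refine ⟨U m, (closure (U (m + m)))ᶜ, fun _ => ⟨⟨ho m (by omega), U,
      fun i hi => ho i (by omega), h0, fun i hi => hc i (by omega), by simp⟩,
      chain_compl ho hc (by omega) hx2, ?_, hth⟩⟩
    refine (hth (U m) subset_rfl).mono_right ?_
    intro z hz V hV
    exact ⟨z, hV.mem, hz⟩
  choose W N hWN using key
  obtain ⟨D, hxD, hD, hcov⟩ := cover_lemma m x W (fun y hy => (hWN y hy).1)
  have hcard : #D ≤ spreadOdd (m+1) X := by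
    refine le_trans ?_ le_sup_left
    exact le_ciSup (f := fun D : {D : Set X // SOddDiscrete (m+1) D} => #D.1)
      (Cardinal.bddAbove_range _) ⟨D, hD⟩
  have hinf : ℵ₀ ≤ spreadOdd (m+1) X := le_sup_right
  have key2 : ∀ C : Set X, ∃ V, SOpenNhd (m+1) x V ∧
      ((∃ V', SOpenNhd (m+1) x V' ∧ Disjoint V' (thetaOdd (m+1) C)) →
        Disjoint V (thetaOdd (m+1) C)) := by
    intro C
    by_cases hC : ∃ V', SOpenNhd (m+1) x V' ∧ Disjoint V' (thetaOdd (m+1) C)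
    · obtain ⟨V, h1, h2⟩ := hC
      exact ⟨V, h1, fun _ => h2⟩
    · exact ⟨univ, ⟨isOpen_univ, fun _ => univ, fun _ _ => isOpen_univ, mem_univ _,
        fun _ _ => subset_univ _, subset_univ _⟩, fun h => absurd h hC⟩
  choose V hV1 hV2 using key2
  refine ⟨Set.image N D ∪ Set.image V (𝒫 D), ?_, ?_, ?_⟩
  · have h2 : #(Set.image V (𝒫 D)) ≤ 2 ^ spreadOdd (m+1) X := by
      refine mk_image_le.trans ?_
      rw [Cardinal.mk_powerset]
      exact Cardinal.power_le_power_left two_ne_zero hcard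
    have h1 : #(Set.image N D) ≤ 2 ^ spreadOdd (m+1) X :=
      mk_image_le.trans (hcard.trans (Cardinal.cantor _).le)
    exact (mk_union_le _ _).trans
      (Cardinal.add_le_of_le (hinf.trans (Cardinal.cantor _).le) h1 h2)
  · rintro U (⟨y, hy, rfl⟩ | ⟨C, _, rfl⟩)
    · exact (hWN y (fun e => hxD (e ▸ hy))).2.1
    · exact hV1 C
  · ext z
    rw [mem_singleton_iff]
    constructor
    · intro hz
      by_contra hne
      rcases hcov z hne with ht | ⟨d, hd, hzd⟩
      · obtain ⟨w1, w2, _, w4⟩ := hWN z hne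
        have hzC : z ∈ thetaOdd (m+1) (D ∩ W z) := by
          intro U hU
          obtain ⟨a, ha, haD⟩ := ht _ (hU.inter' w1)
          exact ⟨a, ha.1, haD, ha.2⟩
        have hdis := hV2 (D ∩ W z) ⟨N z, w2, w4 _ inter_subset_right⟩
        exact Set.disjoint_left.1 hdis
          (hz _ (Or.inr ⟨_, inter_subset_left, rfl⟩)) hzC
      · have hdx : d ≠ x := fun e => hxD (e ▸ hd)
        exact Set.disjoint_left.1 (hWN d hdx).2.2.1 (hz _ (Or.inl ⟨d, hd, rfl⟩)) hzd
    · rintro rfl U (⟨y, hy, rfl⟩ | ⟨C, _, rfl⟩)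
      · exact (hWN y (fun e => hxD (e ▸ hy))).2.1.mem
      · exact (hV1 C).mem

theorem stmt17 (k : ℕ) (hk : 1 ≤ k) (X : Type u) [TopologicalSpace X]
    (h : SSpace (3 * k - 2) X) :
    psiOdd k X ≤ 2 ^ spreadOdd k X := by 
  obtain ⟨m, rfl⟩ : ∃ m, k = m + 1 := ⟨k - 1, by omega⟩
  have h' : SSpace (3 * m + 1) X := by
    rwa [show 3 * (m + 1) - 2 = 3 * m + 1 by omega] at h
  refine csInf_le' ⟨?_, fun x => stmt17_aux m h' x⟩
  exact le_trans le_sup_right (Cardinal.cantor _).le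
end
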